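/- arXiv:0912.0494 — 7 statements merged into one kernel-verified Lean document; each statement's English description precedes it below -/
import Mathlib

section
/- Let a, b be integers with b ≥ a + 2, α, β ∈ ℝ, and let L_Δ, L_∇ : ℤ × ℝ × ℝ → ℝ be such that L_Δ(t,·,·) and L_∇(t,·,·) are continuously differentiable for each t. If ŷ : ℤ → ℝ is a local extremizer of J(y) = J_Δ(y)·J_∇(y) subject to y(a) = α, y(b) = β, then there exists a constant c ∈ ℝ such that for all integers t with a + 1 ≤ t ≤ b: J_∇(ŷ)·(∂₃L_Δ(t−1, ŷ(t), ŷ(t) − ŷ(t−1)) − Σ_{τ=a}^{t−2} ∂₂L_Δ(τ, ŷ(τ+1), ŷ(τ+1) − ŷ(τ))) + J_Δ(ŷ)·(∂₃L_∇(t, ŷ(t−1), ŷ(t) − ŷ(t−1)) − Σ_{τ=a+1}^{t} ∂₂L_∇(τ, ŷ(τ−1), ŷ(τ) − ŷ(τ−1))) = c. (This is the first form (EL1) of the paper's general Euler-Lagrange equation on the time scale T = ℤ.) -/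
/-- Partial derivative of `L t` with respect to its second argument. -/
noncomputable def partial2 (L : ℤ → ℝ → ℝ → ℝ) (t : ℤ) (u v : ℝ) : ℝ :=
  deriv (fun z => L t z v) u

/-- Partial derivative of `L t` with respect to its third argument. -/
noncomputable def partial3 (L : ℤ → ℝ → ℝ → ℝ) (t : ℤ) (u v : ℝ) : ℝ :=
  deriv (fun z => L t u z) v

/-- The delta functional `J_Δ(y) = Σ_{t=a}^{b−1} L(t, y(t+1), y(t+1) − y(t))`
on the time scale `T = ℤ`. -/
noncomputable def deltaFunctional (a b : ℤ) (L : ℤ → ℝ → ℝ → ℝ) (y : ℤ → ℝ) : ℝ :=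
  ∑ t ∈ Finset.Icc a (b - 1), L t (y (t + 1)) (y (t + 1) - y t)

/-- The nabla functional `J_∇(y) = Σ_{t=a+1}^{b} L(t, y(t−1), y(t) − y(t−1))`
on the time scale `T = ℤ`. -/
noncomputable def nablaFunctional (a b : ℤ) (L : ℤ → ℝ → ℝ → ℝ) (y : ℤ → ℝ) : ℝ :=
  ∑ t ∈ Finset.Icc (a + 1) b, L t (y (t - 1)) (y t - y (t - 1))

/-- `yhat` is a local extremizer (minimizer or maximizer) of `F` among functions
with the boundary values `y(a) = α`, `y(b) = β`. -/
def IsLocalExtremizer (a b : ℤ) (α β : ℝ) (F : (ℤ → ℝ) → ℝ) (yhat : ℤ → ℝ) : Prop :=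
  yhat a = α ∧ yhat b = β ∧ ∃ δ > 0,
    (∀ y : ℤ → ℝ, y a = α → y b = β →
      (∀ t ∈ Finset.Icc a b, |y t - yhat t| < δ) → F yhat ≤ F y) ∨
    (∀ y : ℤ → ℝ, y a = α → y b = β →
      (∀ t ∈ Finset.Icc a b, |y t - yhat t| < δ) → F y ≤ F yhat)

theorem hasDerivAt_lagr (L : ℤ → ℝ → ℝ → ℝ) (t : ℤ)
    (hL : ContDiff ℝ 1 (fun p : ℝ × ℝ => L t p.1 p.2)) (u v p q : ℝ) :
    HasDerivAt (fun e : ℝ => L t (u + e * p) (v + e * q))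
      (partial2 L t u v * p + partial3 L t u v * q) 0 := by
  set F : ℝ × ℝ → ℝ := fun p => L t p.1 p.2 with hF
  have hd : HasFDerivAt F (fderiv ℝ F (u, v)) (u, v) :=
    (hL.differentiable (by norm_num) (u, v)).hasFDerivAt
  have h2 : partial2 L t u v = fderiv ℝ F (u, v) (1, 0) := by
    have hc : HasDerivAt (fun z : ℝ => (z, v)) ((1 : ℝ), (0 : ℝ)) u :=
      (hasDerivAt_id u).prodMk (hasDerivAt_const u v)
    exact (hd.comp_hasDerivAt u hc).deriv
  have h3 : partial3 L t u v = fderiv ℝ F (u, v) (0, 1) := by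
    have hc : HasDerivAt (fun z : ℝ => (u, z)) ((0 : ℝ), (1 : ℝ)) v :=
      (hasDerivAt_const v u).prodMk (hasDerivAt_id v)
    exact (hd.comp_hasDerivAt v hc).deriv
  have aux : ∀ w r : ℝ, HasDerivAt (fun e : ℝ => w + e * r) r 0 := by
    intro w r
    simpa using ((hasDerivAt_id (0 : ℝ)).mul_const r).const_add w
  have hc : HasDerivAt (fun e : ℝ => (u + e * p, v + e * q)) (p, q) 0 :=
    (aux u p).prodMk (aux v q)
  have hd' : HasFDerivAt F (fderiv ℝ F (u, v)) (u + 0 * p, v + 0 * q) := by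
    simpa using hd
  have key := hd'.comp_hasDerivAt (0 : ℝ) hc
  have hpq : ((p, q) : ℝ × ℝ) = p • ((1 : ℝ), (0 : ℝ)) + q • ((0 : ℝ), (1 : ℝ)) := by
    simp
  have e : fderiv ℝ F (u, v) (p, q) = partial2 L t u v * p + partial3 L t u v * q := by
    rw [hpq, map_add, map_smul, map_smul, ← h2, ← h3]
    simp only [smul_eq_mul]; ring
  rw [← e]
  exact key

theorem hasDerivAt_deltaF (a b s : ℤ) (hs : a + 1 ≤ s) (hs' : s + 1 ≤ b) (L : ℤ → ℝ → ℝ → ℝ)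
    (hL : ∀ t : ℤ, ContDiff ℝ 1 (fun p : ℝ × ℝ => L t p.1 p.2)) (y : ℤ → ℝ) :
    HasDerivAt (fun e : ℝ => deltaFunctional a b L (fun t => y t + e * (if t = s then 1 else 0)))
      (partial2 L (s - 1) (y s) (y s - y (s - 1)) + partial3 L (s - 1) (y s) (y s - y (s - 1))
        - partial3 L s (y (s + 1)) (y (s + 1) - y s)) 0 := by
  unfold deltaFunctional
  have h := HasDerivAt.fun_sum (u := Finset.Icc a (b - 1)) (fun t _ => hasDerivAt_lagr L t (hL t)
    (y (t + 1)) (y (t + 1) - y t) (if t + 1 = s then 1 else 0)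
    ((if t + 1 = s then 1 else 0) - (if t = s then 1 else 0)))
  refine HasDerivAt.congr_deriv (HasDerivAt.congr_of_eventuallyEq h
    (Filter.Eventually.of_forall fun e => ?_)) ?_
  · refine Finset.sum_congr rfl fun t _ => ?_
    congr 1
    ring
  · simp only [mul_sub, ← add_sub_assoc, ← add_mul]
    have hiff : ∀ t : ℤ, (t + 1 = s) = (t = s - 1) := fun t => propext (by omega)
    simp only [hiff, mul_ite, mul_one, mul_zero, Finset.sum_sub_distrib, Finset.sum_add_distrib,
      Finset.sum_ite_eq', Finset.mem_Icc]
    rw [if_pos (by omega), if_pos (by omega)]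
    simp only [add_sub_cancel_right, sub_add_cancel]

theorem hasDerivAt_nablaF (a b s : ℤ) (hs : a + 1 ≤ s) (hs' : s + 1 ≤ b) (L : ℤ → ℝ → ℝ → ℝ)
    (hL : ∀ t : ℤ, ContDiff ℝ 1 (fun p : ℝ × ℝ => L t p.1 p.2)) (y : ℤ → ℝ) :
    HasDerivAt (fun e : ℝ => nablaFunctional a b L (fun t => y t + e * (if t = s then 1 else 0)))
      (partial2 L (s + 1) (y s) (y (s + 1) - y s) + partial3 L s (y (s - 1)) (y s - y (s - 1))
        - partial3 L (s + 1) (y s) (y (s + 1) - y s)) 0 := by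
  unfold nablaFunctional
  have h := HasDerivAt.fun_sum (u := Finset.Icc (a + 1) b) (fun t _ => hasDerivAt_lagr L t (hL t)
    (y (t - 1)) (y t - y (t - 1)) (if t - 1 = s then 1 else 0)
    ((if t = s then 1 else 0) - (if t - 1 = s then 1 else 0)))
  refine HasDerivAt.congr_deriv (HasDerivAt.congr_of_eventuallyEq h
    (Filter.Eventually.of_forall fun e => ?_)) ?_
  · refine Finset.sum_congr rfl fun t _ => ?_
    congr 1
    ring
  · simp only [mul_sub, ← add_sub_assoc]
    have hiff : ∀ t : ℤ, (t - 1 = s) = (t = s + 1) := fun t => propext (by omega)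
    simp only [hiff, mul_ite, mul_one, mul_zero, Finset.sum_sub_distrib, Finset.sum_add_distrib,
      Finset.sum_ite_eq', Finset.mem_Icc]
    rw [if_pos (⟨by omega, by omega⟩ : a + 1 ≤ s + 1 ∧ s + 1 ≤ b),
      if_pos (⟨by omega, by omega⟩ : a + 1 ≤ s ∧ s ≤ b),
      if_pos (⟨by omega, by omega⟩ : a + 1 ≤ s + 1 ∧ s + 1 ≤ b)]
    simp only [add_sub_cancel_right, sub_add_cancel]

theorem exists_const_of_step (a b : ℤ) (f : ℤ → ℝ)
    (h : ∀ s : ℤ, a + 1 ≤ s → s + 1 ≤ b → f (s + 1) = f s) :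
    ∃ c : ℝ, ∀ t ∈ Finset.Icc (a + 1) b, f t = c := by
  refine ⟨f (a + 1), fun t ht => ?_⟩
  rw [Finset.mem_Icc] at ht
  obtain ⟨h1, h2⟩ := ht
  revert h2
  induction t, h1 using Int.leInduction with
  | base => intro _; rfl
  | succ s hs ih =>
    intro h2
    rw [h s hs h2, ih (by omega)]

/-- The first form (EL1) of the general Euler-Lagrange equation for the
delta-nabla product functional on the time scale `T = ℤ`. -/
theorem eulerLagrange_deltaNabla_EL1_int (a b : ℤ) (hab : a + 2 ≤ b) (α β : ℝ)
    (LD LN : ℤ → ℝ → ℝ → ℝ)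
    (hLD : ∀ t : ℤ, ContDiff ℝ 1 (fun p : ℝ × ℝ => LD t p.1 p.2))
    (hLN : ∀ t : ℤ, ContDiff ℝ 1 (fun p : ℝ × ℝ => LN t p.1 p.2))
    (yhat : ℤ → ℝ)
    (hext : IsLocalExtremizer a b α β
      (fun y => deltaFunctional a b LD y * nablaFunctional a b LN y) yhat) :
    ∃ c : ℝ, ∀ t ∈ Finset.Icc (a + 1) b,
      nablaFunctional a b LN yhat *
        (partial3 LD (t - 1) (yhat t) (yhat t - yhat (t - 1))
          - ∑ τ ∈ Finset.Icc a (t - 2),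
              partial2 LD τ (yhat (τ + 1)) (yhat (τ + 1) - yhat τ)) +
      deltaFunctional a b LD yhat *
        (partial3 LN t (yhat (t - 1)) (yhat t - yhat (t - 1))
          - ∑ τ ∈ Finset.Icc (a + 1) t,
              partial2 LN τ (yhat (τ - 1)) (yhat τ - yhat (τ - 1))) = c := by
  obtain ⟨ha, hb, δ, hδ, hor⟩ := hext
  have stat : ∀ s : ℤ, a + 1 ≤ s → s + 1 ≤ b →
      (partial2 LD (s - 1) (yhat s) (yhat s - yhat (s - 1))
          + partial3 LD (s - 1) (yhat s) (yhat s - yhat (s - 1))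
          - partial3 LD s (yhat (s + 1)) (yhat (s + 1) - yhat s)) * nablaFunctional a b LN yhat +
      deltaFunctional a b LD yhat *
        (partial2 LN (s + 1) (yhat s) (yhat (s + 1) - yhat s)
          + partial3 LN s (yhat (s - 1)) (yhat s - yhat (s - 1))
          - partial3 LN (s + 1) (yhat s) (yhat (s + 1) - yhat s)) = 0 := by
    intro s hs hs'
    have hd := (hasDerivAt_deltaF a b s hs hs' LD hLD yhat).fun_mul
      (hasDerivAt_nablaF a b s hs hs' LN hLN yhat)
    simp only [zero_mul, add_zero] at hd
    have hea : ∀ e : ℝ, yhat a + e * (if a = s then 1 else 0) = α := by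
      intro e; rw [if_neg (by omega)]; simpa using ha
    have heb : ∀ e : ℝ, yhat b + e * (if b = s then 1 else 0) = β := by
      intro e; rw [if_neg (by omega)]; simpa using hb
    have hnear : ∀ e : ℝ, |e| < δ → ∀ t ∈ Finset.Icc a b,
        |(yhat t + e * (if t = s then 1 else 0)) - yhat t| < δ := by
      intro e he t _
      split_ifs <;> simpa
    have hev : ∀ᶠ e : ℝ in nhds 0, |e| < δ := by
      have := Metric.ball_mem_nhds (0 : ℝ) hδ
      filter_upwards [this] with e he
      simpa using he
    have hloc : IsLocalExtr (fun e : ℝ =>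
        deltaFunctional a b LD (fun t => yhat t + e * (if t = s then 1 else 0)) *
        nablaFunctional a b LN (fun t => yhat t + e * (if t = s then 1 else 0))) 0 := by
      rcases hor with hmin | hmax
      · left
        filter_upwards [hev] with e he
        have := hmin (fun t => yhat t + e * (if t = s then 1 else 0)) (hea e) (heb e) (hnear e he)
        simpa only [zero_mul, add_zero] using this
      · right
        filter_upwards [hev] with e he
        have := hmax (fun t => yhat t + e * (if t = s then 1 else 0)) (hea e) (heb e) (hnear e he)
        simpa only [zero_mul, add_zero] using this
    exact hloc.hasDerivAt_eq_zero hd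
  refine exists_const_of_step a b _ fun s hs h2 => ?_
  have e1 : Finset.Icc a (s + 1 - 2) = insert (s - 1) (Finset.Icc a (s - 2)) := by
    ext x; simp only [Finset.mem_insert, Finset.mem_Icc]; omega
  have e2 : Finset.Icc (a + 1) (s + 1) = insert (s + 1) (Finset.Icc (a + 1) s) := by
    ext x; simp only [Finset.mem_insert, Finset.mem_Icc]; omega
  rw [e1, e2, Finset.sum_insert (by rw [Finset.mem_Icc]; omega),
    Finset.sum_insert (by rw [Finset.mem_Icc]; omega)]
  have := stat s hs h2
  simp only [add_sub_cancel_right, sub_add_cancel]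
  linarith
end

section
/- Let a, b be integers with b ≥ a + 2, α, β ∈ ℝ, and let L_Δ, L_∇ : ℤ × ℝ × ℝ → ℝ be such that L_Δ(t,·,·) and L_∇(t,·,·) are continuously differentiable for each t. If ŷ : ℤ → ℝ is a local extremizer of J(y) = J_Δ(y)·J_∇(y) subject to y(a) = α, y(b) = β, then there exists a constant c ∈ ℝ such that for all integers t with a ≤ t ≤ b − 1: J_∇(ŷ)·(∂₃L_Δ(t, ŷ(t+1), ŷ(t+1) − ŷ(t)) − Σ_{τ=a}^{t−1} ∂₂L_Δ(τ, ŷ(τ+1), ŷ(τ+1) − ŷ(τ))) + J_Δ(ŷ)·(∂₃L_∇(t+1, ŷ(t), ŷ(t+1) − ŷ(t)) − Σ_{τ=a+1}^{t+1} ∂₂L_∇(τ, ŷ(τ−1), ŷ(τ) − ŷ(τ−1))) = c. (This is the second form (EL2) of the paper's general Euler-Lagrange equation on the time scale T = ℤ.) -/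
theorem aux_hasDeriv (L : ℤ → ℝ → ℝ → ℝ) (t : ℤ)
    (hL : ContDiff ℝ 1 (fun p : ℝ × ℝ => L t p.1 p.2)) (u v p q : ℝ) :
    HasDerivAt (fun ε : ℝ => L t (u + ε * p) (v + ε * q))
      (partial2 L t u v * p + partial3 L t u v * q) 0 := by
  have hd : HasFDerivAt (fun p : ℝ × ℝ => L t p.1 p.2)
      (fderiv ℝ (fun p : ℝ × ℝ => L t p.1 p.2) (u, v)) (u, v) :=
    (hL.differentiable (by norm_num)).differentiableAt.hasFDerivAt
  set D := fderiv ℝ (fun p : ℝ × ℝ => L t p.1 p.2) (u, v) with hD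
  have h2 : HasDerivAt (fun z => L t z v) (D (1, 0)) u :=
    HasFDerivAt.comp_hasDerivAt (f := fun z : ℝ => (z, v)) u hd
      ((hasDerivAt_id u).prodMk (hasDerivAt_const u v))
  have h3 : HasDerivAt (fun z => L t u z) (D (0, 1)) v :=
    HasFDerivAt.comp_hasDerivAt (f := fun z : ℝ => (u, z)) v hd
      ((hasDerivAt_const v u).prodMk (hasDerivAt_id v))
  have e2 : partial2 L t u v = D (1, 0) := h2.deriv
  have e3 : partial3 L t u v = D (0, 1) := h3.deriv
  have hl : ∀ w r : ℝ, HasDerivAt (fun ε : ℝ => w + ε * r) r 0 := fun w r => by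
    simpa using ((hasDerivAt_id (0 : ℝ)).mul_const r).const_add w
  have hd' : HasFDerivAt (fun p : ℝ × ℝ => L t p.1 p.2) D
      ((fun ε : ℝ => (u + ε * p, v + ε * q)) 0) := by simpa using hd
  have h := HasFDerivAt.comp_hasDerivAt (f := fun ε : ℝ => (u + ε * p, v + ε * q)) 0 hd'
      ((hl u p).prodMk (hl v q))
  have e : D (p, q) = partial2 L t u v * p + partial3 L t u v * q := by
    have : ((p, q) : ℝ × ℝ) = p • ((1 : ℝ), (0 : ℝ)) + q • ((0 : ℝ), (1 : ℝ)) := by simp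
    rw [this, map_add, map_smul, map_smul, e2, e3]
    simp [mul_comm]
  rw [← e]
  exact h

theorem aux_delta (a b s : ℤ) (has : a < s) (hsb : s < b) (L : ℤ → ℝ → ℝ → ℝ)
    (hL : ∀ t : ℤ, ContDiff ℝ 1 (fun p : ℝ × ℝ => L t p.1 p.2)) (y : ℤ → ℝ) :
    HasDerivAt (fun ε : ℝ => deltaFunctional a b L (fun t => y t + ε * (if t = s then 1 else 0)))
      (partial2 L (s - 1) (y s) (y s - y (s - 1)) + partial3 L (s - 1) (y s) (y s - y (s - 1))
        - partial3 L s (y (s + 1)) (y (s + 1) - y s)) 0 := by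
  have h : HasDerivAt (fun ε : ℝ => ∑ t ∈ Finset.Icc a (b - 1),
      L t (y (t + 1) + ε * (if t + 1 = s then 1 else 0))
        ((y (t + 1) - y t) + ε * ((if t + 1 = s then 1 else 0) - (if t = s then 1 else 0)))) _ 0 :=
    HasDerivAt.fun_sum (fun t _ => aux_hasDeriv L t (hL t) _ _ _ _)
  convert h using 1
  · funext ε
    unfold deltaFunctional
    refine Finset.sum_congr rfl fun t _ => ?_
    congr 1
    ring
  · have e : ∀ t : ℤ, (t + 1 = s) = (t = s - 1) := fun t => propext (by omega)
    simp only [e, mul_sub, Finset.sum_add_distrib, Finset.sum_sub_distrib, mul_ite, mul_one,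
      mul_zero, Finset.sum_ite_eq', Finset.mem_Icc]
    rw [if_pos (by omega), if_pos (by omega), if_pos (by omega)]
    simp only [sub_add_cancel]
    ring

theorem aux_nabla (a b s : ℤ) (has : a < s) (hsb : s < b) (L : ℤ → ℝ → ℝ → ℝ)
    (hL : ∀ t : ℤ, ContDiff ℝ 1 (fun p : ℝ × ℝ => L t p.1 p.2)) (y : ℤ → ℝ) :
    HasDerivAt (fun ε : ℝ => nablaFunctional a b L (fun t => y t + ε * (if t = s then 1 else 0)))
      (partial2 L (s + 1) (y s) (y (s + 1) - y s) + partial3 L s (y (s - 1)) (y s - y (s - 1))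
        - partial3 L (s + 1) (y s) (y (s + 1) - y s)) 0 := by
  have h : HasDerivAt (fun ε : ℝ => ∑ t ∈ Finset.Icc (a + 1) b,
      L t (y (t - 1) + ε * (if t - 1 = s then 1 else 0))
        ((y t - y (t - 1)) + ε * ((if t = s then 1 else 0) - (if t - 1 = s then 1 else 0)))) _ 0 :=
    HasDerivAt.fun_sum (fun t _ => aux_hasDeriv L t (hL t) _ _ _ _)
  convert h using 1
  · funext ε
    unfold nablaFunctional
    refine Finset.sum_congr rfl fun t _ => ?_
    congr 1
    ring
  · have e : ∀ t : ℤ, (t - 1 = s) = (t = s + 1) := fun t => propext (by omega)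
    simp only [e, mul_sub, Finset.sum_add_distrib, Finset.sum_sub_distrib, mul_ite, mul_one,
      mul_zero, Finset.sum_ite_eq', Finset.mem_Icc]
    rw [if_pos (by omega), if_pos (by omega), if_pos (by omega)]
    simp only [add_sub_cancel_right]
    ring

theorem aux_sum (a n : ℤ) (h : a ≤ n) (f : ℤ → ℝ) :
    ∑ τ ∈ Finset.Icc a n, f τ = ∑ τ ∈ Finset.Icc a (n - 1), f τ + f n := by
  have : Finset.Icc a n = insert n (Finset.Icc a (n - 1)) := by
    ext x
    simp only [Finset.mem_Icc, Finset.mem_insert]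
    omega
  rw [this, Finset.sum_insert (by simp), add_comm]

theorem aux_const (a b : ℤ) (E : ℤ → ℝ)
    (h : ∀ n, a ≤ n → n + 1 ≤ b - 1 → E (n + 1) = E n) :
    ∃ c : ℝ, ∀ t ∈ Finset.Icc a (b - 1), E t = c := by
  refine ⟨E a, fun t ht => ?_⟩
  rw [Finset.mem_Icc] at ht
  obtain ⟨hat, htb⟩ := ht
  revert htb
  induction t, hat using Int.le_induction with
  | base => intro _; rfl
  | succ n hn ih =>
    intro htb
    rw [← ih (by omega)]
    exact h n hn htb

/-- The second form (EL2) of the general Euler-Lagrange equation for the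
delta-nabla product functional on the time scale `T = ℤ`. -/
theorem eulerLagrange_deltaNabla_EL2_int (a b : ℤ) (hab : a + 2 ≤ b) (α β : ℝ)
    (LD LN : ℤ → ℝ → ℝ → ℝ)
    (hLD : ∀ t : ℤ, ContDiff ℝ 1 (fun p : ℝ × ℝ => LD t p.1 p.2))
    (hLN : ∀ t : ℤ, ContDiff ℝ 1 (fun p : ℝ × ℝ => LN t p.1 p.2))
    (yhat : ℤ → ℝ)
    (hext : IsLocalExtremizer a b α β
      (fun y => deltaFunctional a b LD y * nablaFunctional a b LN y) yhat) :
    ∃ c : ℝ, ∀ t ∈ Finset.Icc a (b - 1),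
      nablaFunctional a b LN yhat *
        (partial3 LD t (yhat (t + 1)) (yhat (t + 1) - yhat t)
          - ∑ τ ∈ Finset.Icc a (t - 1),
              partial2 LD τ (yhat (τ + 1)) (yhat (τ + 1) - yhat τ)) +
      deltaFunctional a b LD yhat *
        (partial3 LN (t + 1) (yhat t) (yhat (t + 1) - yhat t)
          - ∑ τ ∈ Finset.Icc (a + 1) (t + 1),
              partial2 LN τ (yhat (τ - 1)) (yhat τ - yhat (τ - 1))) = c := by
  obtain ⟨ha, hb, δ, hδ, hext⟩ := hext
  have key : ∀ s : ℤ, a < s → s < b →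
      (partial2 LD (s - 1) (yhat s) (yhat s - yhat (s - 1))
          + partial3 LD (s - 1) (yhat s) (yhat s - yhat (s - 1))
          - partial3 LD s (yhat (s + 1)) (yhat (s + 1) - yhat s)) * nablaFunctional a b LN yhat
        + deltaFunctional a b LD yhat *
          (partial2 LN (s + 1) (yhat s) (yhat (s + 1) - yhat s)
          + partial3 LN s (yhat (s - 1)) (yhat s - yhat (s - 1))
          - partial3 LN (s + 1) (yhat s) (yhat (s + 1) - yhat s)) = 0 := by
    intro s has hsb
    have hder := (aux_delta a b s has hsb LD hLD yhat).mul (aux_nabla a b s has hsb LN hLN yhat)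
    have hloc : IsLocalExtr ((fun ε : ℝ => deltaFunctional a b LD
          (fun t => yhat t + ε * (if t = s then 1 else 0))) *
        (fun ε : ℝ => nablaFunctional a b LN
          (fun t => yhat t + ε * (if t = s then 1 else 0)))) 0 := by
      have hev : ∀ᶠ ε : ℝ in nhds 0, |ε| < δ := by
        have := Metric.ball_mem_nhds (0 : ℝ) hδ
        filter_upwards [this] with ε hε
        simpa using hε
      have h1 : ∀ ε : ℝ, yhat a + ε * (if a = s then 1 else 0) = α := fun ε => by
        rw [if_neg (by omega)]; simp [ha]
      have h2 : ∀ ε : ℝ, yhat b + ε * (if b = s then 1 else 0) = β := fun ε => by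
        rw [if_neg (by omega)]; simp [hb]
      have h3 : ∀ ε : ℝ, |ε| < δ → ∀ t ∈ Finset.Icc a b,
          |yhat t + ε * (if t = s then 1 else 0) - yhat t| < δ := fun ε hε t _ => by
        split_ifs <;> simp [hε, hδ]
      rcases hext with hm | hm
      · left
        filter_upwards [hev] with ε hε
        simpa using hm (fun t => yhat t + ε * (if t = s then 1 else 0)) (h1 ε) (h2 ε) (h3 ε hε)
      · right
        filter_upwards [hev] with ε hε
        simpa using hm (fun t => yhat t + ε * (if t = s then 1 else 0)) (h1 ε) (h2 ε) (h3 ε hε)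
    have h0 := hloc.hasDerivAt_eq_zero hder
    simpa only [zero_mul, add_zero] using h0
  refine aux_const a b _ fun n hn htb => ?_
  have k := key (n + 1) (by omega) (by omega)
  rw [aux_sum a (n + 1 - 1) (by omega), aux_sum (a + 1) (n + 1 + 1) (by omega)]
  simp only [add_sub_cancel_right] at k ⊢
  linear_combination -k
end

section
/- Let a, b be integers with b ≥ a + 2, α, β ∈ ℝ, and let L : ℤ × ℝ × ℝ → ℝ be such that L(t,·,·) is continuously differentiable for each t. If ŷ : ℤ → ℝ is a local extremizer of J_Δ(y) = Σ_{t=a}^{b−1} L(t, y(t+1), y(t+1) − y(t)) subject to y(a) = α, y(b) = β, then there exists a constant c ∈ ℝ such that ∂₃L(t, ŷ(t+1), ŷ(t+1) − ŷ(t)) − Σ_{τ=a}^{t−1} ∂₂L(τ, ŷ(τ+1), ŷ(τ+1) − ŷ(τ)) = c for all integers t with a ≤ t ≤ b − 1. (This is the paper's corollary (cor:EL2), the delta Euler-Lagrange equation in integral form, on the time scale T = ℤ.) -/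
theorem hasDerivAt_term (L : ℤ → ℝ → ℝ → ℝ)
    (hL : ∀ t : ℤ, ContDiff ℝ 1 (fun p : ℝ × ℝ => L t p.1 p.2)) (t : ℤ) (u v p q : ℝ) :
    HasDerivAt (fun e : ℝ => L t (u + e * p) (v + e * q))
      (p * partial2 L t u v + q * partial3 L t u v) 0 := by
  have hd : HasFDerivAt (fun p : ℝ × ℝ => L t p.1 p.2)
      (fderiv ℝ (fun p : ℝ × ℝ => L t p.1 p.2) (u, v)) (u, v) :=
    ((hL t).differentiable (by norm_num) (u, v)).hasFDerivAt
  set D := fderiv ℝ (fun p : ℝ × ℝ => L t p.1 p.2) (u, v) with hD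
  have h2 : partial2 L t u v = D (1, 0) := by
    have h : HasDerivAt (fun z : ℝ => (z, v)) ((1 : ℝ), (0 : ℝ)) u :=
      (hasDerivAt_id u).prodMk (hasDerivAt_const u v)
    exact (HasFDerivAt.comp_hasDerivAt (f := fun z : ℝ => (z, v)) u hd h).deriv
  have h3 : partial3 L t u v = D (0, 1) := by
    have h : HasDerivAt (fun z : ℝ => (u, z)) ((0 : ℝ), (1 : ℝ)) v :=
      (hasDerivAt_const v u).prodMk (hasDerivAt_id v)
    exact (HasFDerivAt.comp_hasDerivAt (f := fun z : ℝ => (u, z)) v hd h).deriv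
  have hc : HasDerivAt (fun e : ℝ => (u + e * p, v + e * q)) (p, q) 0 := by
    have e1 : HasDerivAt (fun e : ℝ => u + e * p) p 0 := by
      simpa using ((hasDerivAt_id (0 : ℝ)).mul_const p).const_add u
    have e2 : HasDerivAt (fun e : ℝ => v + e * q) q 0 := by
      simpa using ((hasDerivAt_id (0 : ℝ)).mul_const q).const_add v
    exact e1.prodMk e2
  have hd' : HasFDerivAt (fun p : ℝ × ℝ => L t p.1 p.2) D
      ((fun e : ℝ => (u + e * p, v + e * q)) 0) := by simpa using hd
  have := HasFDerivAt.comp_hasDerivAt (f := fun e : ℝ => (u + e * p, v + e * q)) 0 hd' hc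
  have hpq : p * partial2 L t u v + q * partial3 L t u v = D (p, q) := by
    have : ((p, q) : ℝ × ℝ) = p • ((1 : ℝ), (0 : ℝ)) + q • ((0 : ℝ), (1 : ℝ)) := by simp
    rw [this, map_add, map_smul, map_smul, h2, h3]
    simp
  rw [hpq]
  exact this

theorem step_eq (a b : ℤ) (α β : ℝ) (L : ℤ → ℝ → ℝ → ℝ)
    (hL : ∀ t : ℤ, ContDiff ℝ 1 (fun p : ℝ × ℝ => L t p.1 p.2))
    (yhat : ℤ → ℝ)
    (hext : IsLocalExtremizer a b α β (fun y => deltaFunctional a b L y) yhat)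
    (s : ℤ) (h1 : a ≤ s) (h2 : s + 1 ≤ b - 1) :
    partial3 L (s + 1) (yhat (s + 1 + 1)) (yhat (s + 1 + 1) - yhat (s + 1)) =
      partial3 L s (yhat (s + 1)) (yhat (s + 1) - yhat s) +
      partial2 L s (yhat (s + 1)) (yhat (s + 1) - yhat s) := by
  obtain ⟨ha, hb, δ, hδ, hext⟩ := hext
  set h : ℤ → ℝ := fun t => if t = s + 1 then 1 else 0 with hh
  have hder : HasDerivAt (fun e : ℝ => deltaFunctional a b L (fun t => yhat t + e * h t))
      (∑ t ∈ Finset.Icc a (b - 1),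
        (h (t + 1) * partial2 L t (yhat (t + 1)) (yhat (t + 1) - yhat t) +
        (h (t + 1) - h t) * partial3 L t (yhat (t + 1)) (yhat (t + 1) - yhat t))) 0 := by
    unfold deltaFunctional
    apply HasDerivAt.fun_sum
    intro t _
    have := hasDerivAt_term L hL t (yhat (t + 1)) (yhat (t + 1) - yhat t) (h (t + 1))
      (h (t + 1) - h t)
    have he : ∀ e : ℝ, yhat (t + 1) + e * h (t + 1) - (yhat t + e * h t) =
        yhat (t + 1) - yhat t + e * (h (t + 1) - h t) := fun e => by ring
    simp only [he]
    exact this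
  have hnear : ∀ᶠ e : ℝ in nhds 0, (yhat a + e * h a = α) ∧ (yhat b + e * h b = β) ∧
      ∀ t ∈ Finset.Icc a b, |(yhat t + e * h t) - yhat t| < δ := by
    filter_upwards [Metric.ball_mem_nhds (0 : ℝ) hδ] with e he
    rw [Metric.mem_ball, dist_zero_right, Real.norm_eq_abs] at he
    refine ⟨?_, ?_, ?_⟩
    · have : ¬ a = s + 1 := by omega
      simp [hh, this, ha]
    · have : ¬ b = s + 1 := by omega
      simp [hh, this, hb]
    · intro t _
      by_cases ht : t = s + 1
      · simpa [hh, ht] using he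
      · simpa [hh, ht] using hδ
  have hloc : IsLocalExtr (fun e : ℝ => deltaFunctional a b L (fun t => yhat t + e * h t)) 0 := by
    rcases hext with hm | hm
    · left
      filter_upwards [hnear] with e he
      simpa using hm _ he.1 he.2.1 he.2.2
    · right
      filter_upwards [hnear] with e he
      simpa using hm _ he.1 he.2.1 he.2.2
  have hz := hloc.hasDerivAt_eq_zero hder
  have m1 : a ≤ s ∧ s ≤ b - 1 := by omega
  have m2 : a ≤ s + 1 ∧ s + 1 ≤ b - 1 := by omega
  simp only [hh, sub_mul, ite_mul, one_mul, zero_mul, add_left_inj, Finset.sum_add_distrib,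
    Finset.sum_sub_distrib, Finset.sum_ite_eq', Finset.mem_Icc, m1, m2, and_self, if_true] at hz
  linarith

/-- The delta Euler-Lagrange equation in integral form on the time scale `T = ℤ`. -/
theorem eulerLagrange_delta_integralForm_int (a b : ℤ) (hab : a + 2 ≤ b) (α β : ℝ)
    (L : ℤ → ℝ → ℝ → ℝ)
    (hL : ∀ t : ℤ, ContDiff ℝ 1 (fun p : ℝ × ℝ => L t p.1 p.2))
    (yhat : ℤ → ℝ)
    (hext : IsLocalExtremizer a b α β (fun y => deltaFunctional a b L y) yhat) :
    ∃ c : ℝ, ∀ t ∈ Finset.Icc a (b - 1),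
      partial3 L t (yhat (t + 1)) (yhat (t + 1) - yhat t)
        - (∑ τ ∈ Finset.Icc a (t - 1),
            partial2 L τ (yhat (τ + 1)) (yhat (τ + 1) - yhat τ)) = c := by
  refine ⟨partial3 L a (yhat (a + 1)) (yhat (a + 1) - yhat a), ?_⟩
  intro t ht
  rw [Finset.mem_Icc] at ht
  obtain ⟨h1, h2⟩ := ht
  induction t, h1 using Int.le_induction with
  | base => simp
  | succ s hs ih =>
    have ih := ih (by omega)
    have hst := step_eq a b α β L hL yhat hext s hs h2
    have hI : Finset.Icc a (s + 1 - 1) = insert s (Finset.Icc a (s - 1)) := by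
      ext x
      simp only [Finset.mem_Icc, Finset.mem_insert]
      omega
    rw [hI, Finset.sum_insert (by simp)]
    linarith
end

section
/- Let a, b be integers with b ≥ a + 2, α, β ∈ ℝ, and let L : ℤ × ℝ × ℝ → ℝ be such that L(t,·,·) is continuously differentiable for each t. If ŷ : ℤ → ℝ is a local extremizer of J_∇(y) = Σ_{t=a+1}^{b} L(t, y(t−1), y(t) − y(t−1)) subject to y(a) = α, y(b) = β, then there exists a constant c ∈ ℝ such that ∂₃L(t, ŷ(t−1), ŷ(t) − ŷ(t−1)) − Σ_{τ=a+1}^{t} ∂₂L(τ, ŷ(τ−1), ŷ(τ) − ŷ(τ−1)) = c for all integers t with a + 1 ≤ t ≤ b. (This is the paper's corollary (cor:EL1), the nabla Euler-Lagrange equation in integral form, on the time scale T = ℤ.) -/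
theorem nabla_term_hasDerivAt (f : ℝ → ℝ → ℝ)
    (hf : ContDiff ℝ 1 (fun p : ℝ × ℝ => f p.1 p.2)) (u v p q : ℝ) :
    HasDerivAt (fun ε : ℝ => f (u + ε * p) (v + ε * q))
      (deriv (fun z => f z v) u * p + deriv (fun z => f u z) v * q) 0 := by
  have hd : HasFDerivAt (fun p : ℝ × ℝ => f p.1 p.2)
      (fderiv ℝ (fun p : ℝ × ℝ => f p.1 p.2) (u, v)) (u, v) :=
    ((hf.differentiable (by norm_num)) (u, v)).hasFDerivAt
  set D := fderiv ℝ (fun p : ℝ × ℝ => f p.1 p.2) (u, v) with hD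
  have h1 : HasDerivAt (fun z => f z v) (D (1, 0)) u :=
    HasFDerivAt.comp_hasDerivAt (f := fun z : ℝ => (z, v)) u hd
      ((hasDerivAt_id u).prodMk (hasDerivAt_const u v))
  have h2 : HasDerivAt (fun z => f u z) (D (0, 1)) v :=
    HasFDerivAt.comp_hasDerivAt (f := fun z : ℝ => (u, z)) v hd
      ((hasDerivAt_const v u).prodMk (hasDerivAt_id v))
  have hlin : ∀ w r : ℝ, HasDerivAt (fun ε : ℝ => w + ε * r) r 0 := by
    intro w r
    simpa using ((hasDerivAt_id (0 : ℝ)).mul_const r).const_add w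
  have hd' : HasFDerivAt (fun p : ℝ × ℝ => f p.1 p.2) D
      ((fun ε : ℝ => (u + ε * p, v + ε * q)) 0) := by simpa using hd
  have h3 : HasDerivAt (fun ε : ℝ => f (u + ε * p) (v + ε * q)) (D (p, q)) 0 :=
    HasFDerivAt.comp_hasDerivAt (f := fun ε : ℝ => (u + ε * p, v + ε * q)) 0 hd'
      ((hlin u p).prodMk (hlin v q))
  rw [h1.deriv, h2.deriv]
  have : D (p, q) = D (1, 0) * p + D (0, 1) * q := by
    have e : ((p, q) : ℝ × ℝ) = p • ((1, 0) : ℝ × ℝ) + q • ((0, 1) : ℝ × ℝ) := by simp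
    rw [e, map_add, map_smul, map_smul]
    simp [mul_comm]
  rw [← this]
  exact h3

/-- The nabla Euler-Lagrange equation in integral form on the time scale `T = ℤ`. -/
theorem eulerLagrange_nabla_integralForm_int (a b : ℤ) (hab : a + 2 ≤ b) (α β : ℝ)
    (L : ℤ → ℝ → ℝ → ℝ)
    (hL : ∀ t : ℤ, ContDiff ℝ 1 (fun p : ℝ × ℝ => L t p.1 p.2))
    (yhat : ℤ → ℝ)
    (hext : IsLocalExtremizer a b α β (fun y => nablaFunctional a b L y) yhat) :
    ∃ c : ℝ, ∀ t ∈ Finset.Icc (a + 1) b,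
      partial3 L t (yhat (t - 1)) (yhat t - yhat (t - 1))
        - (∑ τ ∈ Finset.Icc (a + 1) t,
            partial2 L τ (yhat (τ - 1)) (yhat τ - yhat (τ - 1))) = c := by
  obtain ⟨ha, hb, δ, hδ, hmm⟩ := hext
  set P2 : ℤ → ℝ := fun τ => partial2 L τ (yhat (τ - 1)) (yhat τ - yhat (τ - 1)) with hP2
  set P3 : ℤ → ℝ := fun τ => partial3 L τ (yhat (τ - 1)) (yhat τ - yhat (τ - 1)) with hP3
  have key : ∀ s : ℤ, a + 1 ≤ s → s + 1 ≤ b → P3 (s + 1) = P3 s + P2 (s + 1) := by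
    intro s hs1 hs2
    let e : ℤ → ℝ := fun t => if t = s then 1 else 0
    let Y : ℝ → ℤ → ℝ := fun ε t => yhat t + ε * e t
    have hY0 : Y 0 = yhat := by funext t; simp [Y]
    have hYa : ∀ ε, Y ε a = α := by
      intro ε
      have : a ≠ s := by omega
      simp [Y, e, this, ha]
    have hYb : ∀ ε, Y ε b = β := by
      intro ε
      have : b ≠ s := by omega
      simp [Y, e, this, hb]
    have hYd : ∀ ε, |ε| < δ → ∀ t ∈ Finset.Icc a b, |Y ε t - yhat t| < δ := by
      intro ε hε t _
      by_cases h : t = s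
      · simpa [Y, e, h] using hε
      · simpa [Y, e, h] using hδ
    have hnear : ∀ᶠ ε : ℝ in nhds 0, |ε| < δ := by
      filter_upwards [Metric.ball_mem_nhds (0 : ℝ) hδ] with ε hε
      simpa using hε
    have hextr : IsLocalExtr (fun ε => nablaFunctional a b L (Y ε)) 0 := by
      rcases hmm with h | h
      · left
        filter_upwards [hnear] with ε hε
        have := h (Y ε) (hYa ε) (hYb ε) (hYd ε hε)
        simpa [hY0] using this
      · right
        filter_upwards [hnear] with ε hε
        have := h (Y ε) (hYa ε) (hYb ε) (hYd ε hε)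
        simpa [hY0] using this
    have hder : HasDerivAt (fun ε => nablaFunctional a b L (Y ε))
        (∑ t ∈ Finset.Icc (a + 1) b, (P2 t * e (t - 1) + P3 t * (e t - e (t - 1)))) 0 := by
      unfold nablaFunctional
      apply HasDerivAt.fun_sum
      intro t _
      have := nabla_term_hasDerivAt (L t) (hL t) (yhat (t - 1)) (yhat t - yhat (t - 1))
        (e (t - 1)) (e t - e (t - 1))
      have hfun : (fun ε : ℝ => L t (Y ε (t - 1)) (Y ε t - Y ε (t - 1)))
          = fun ε : ℝ => L t (yhat (t - 1) + ε * e (t - 1))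
            (yhat t - yhat (t - 1) + ε * (e t - e (t - 1))) := by
        funext ε
        simp only [Y]
        congr 1
        ring
      rw [hfun]
      exact this
    have hz := hextr.hasDerivAt_eq_zero hder
    have hsum : ∑ t ∈ Finset.Icc (a + 1) b, (P2 t * e (t - 1) + P3 t * (e t - e (t - 1)))
        = ∑ t ∈ Finset.Icc (a + 1) b, ((if t = s + 1 then P2 t - P3 t else 0)
            + (if t = s then P3 t else 0)) := by
      apply Finset.sum_congr rfl
      intro t _
      have : (t - 1 = s) ↔ (t = s + 1) := by omega
      simp only [e, this]
      split_ifs <;> ring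
    rw [hsum, Finset.sum_add_distrib, Finset.sum_ite_eq', Finset.sum_ite_eq',
      if_pos (Finset.mem_Icc.2 ⟨by omega, by omega⟩),
      if_pos (Finset.mem_Icc.2 ⟨by omega, by omega⟩)] at hz
    linarith
  refine ⟨P3 (a + 1) - P2 (a + 1), ?_⟩
  intro t ht
  obtain ⟨ht1, ht2⟩ := Finset.mem_Icc.1 ht
  change P3 t - ∑ τ ∈ Finset.Icc (a + 1) t, P2 τ = _
  clear ht
  induction t, ht1 using Int.le_induction with
  | base => simp
  | succ n hn ih =>
    have hI : Finset.Icc (a + 1) (n + 1) = insert (n + 1) (Finset.Icc (a + 1) n) := by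
      ext x
      simp only [Finset.mem_Icc, Finset.mem_insert]
      omega
    rw [hI, Finset.sum_insert (by simp), key n hn ht2, ← ih (by omega)]
    ring
end

section
/- Let a, b be integers with b ≥ a + 2, α, β ∈ ℝ, and let L : ℤ × ℝ × ℝ → ℝ be such that L(t,·,·) is continuously differentiable for each t. If ŷ : ℤ → ℝ is a local extremizer of J_Δ(y) = Σ_{t=a}^{b−1} L(t, y(t+1), y(t+1) − y(t)) subject to y(a) = α, y(b) = β, then ŷ satisfies the delta Euler-Lagrange difference equation: ∂₃L(t+1, ŷ(t+2), ŷ(t+2) − ŷ(t+1)) − ∂₃L(t, ŷ(t+1), ŷ(t+1) − ŷ(t)) = ∂₂L(t, ŷ(t+1), ŷ(t+1) − ŷ(t)) for all integers t with a ≤ t ≤ b − 2. -/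
/-- Chain rule for `L t` along a line in the plane. -/
lemma hasDerivAt_along_line (f : ℝ → ℝ → ℝ) (hf : ContDiff ℝ 1 (fun p : ℝ × ℝ => f p.1 p.2))
    (u v c d : ℝ) :
    HasDerivAt (fun s : ℝ => f (u + s * c) (v + s * d))
      (deriv (fun z => f z v) u * c + deriv (fun z => f u z) v * d) 0 := by
  have hd : DifferentiableAt ℝ (fun p : ℝ × ℝ => f p.1 p.2) (u, v) :=
    (hf.differentiable (by norm_num)) (u, v)
  have key : ∀ (g h : ℝ → ℝ) (gd hd2 x : ℝ), g x = u → h x = v → HasDerivAt g gd x →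
      HasDerivAt h hd2 x → HasDerivAt (fun s => f (g s) (h s))
        (fderiv ℝ (fun p : ℝ × ℝ => f p.1 p.2) (u, v) (gd, hd2)) x := by
    intro g h gd hd2 x hg hh hgd hhd
    have h1 : HasFDerivAt (fun p : ℝ × ℝ => f p.1 p.2)
        (fderiv ℝ (fun p : ℝ × ℝ => f p.1 p.2) (u, v)) ((fun s => (g s, h s)) x) := by
      simpa [hg, hh] using hd.hasFDerivAt
    exact h1.comp_hasDerivAt x (hgd.prodMk hhd)
  have h2 := (key (fun z => z) (fun _ => v) 1 0 u rfl rfl (hasDerivAt_id u)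
    (hasDerivAt_const u v)).deriv
  have h3 := (key (fun _ => u) (fun z => z) 0 1 v rfl rfl (hasDerivAt_const v u)
    (hasDerivAt_id v)).deriv
  have h4 := key (fun s => u + s * c) (fun s => v + s * d) c d 0 (by simp) (by simp)
    (by simpa using ((hasDerivAt_id (0 : ℝ)).mul_const c).const_add u)
    (by simpa using ((hasDerivAt_id (0 : ℝ)).mul_const d).const_add v)
  have h5 : ((c, d) : ℝ × ℝ) = c • ((1, 0) : ℝ × ℝ) + d • ((0, 1) : ℝ × ℝ) := by
    simp
  rw [h5, map_add, map_smul, map_smul, ← h2, ← h3] at h4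
  simpa [smul_eq_mul, mul_comm] using h4

/-- The delta Euler-Lagrange difference equation on the time scale `T = ℤ`. -/
theorem eulerLagrange_delta_differenceForm_int (a b : ℤ) (hab : a + 2 ≤ b) (α β : ℝ)
    (L : ℤ → ℝ → ℝ → ℝ)
    (hL : ∀ t : ℤ, ContDiff ℝ 1 (fun p : ℝ × ℝ => L t p.1 p.2))
    (yhat : ℤ → ℝ)
    (hext : IsLocalExtremizer a b α β (fun y => deltaFunctional a b L y) yhat) :
    ∀ t ∈ Finset.Icc a (b - 2),
      partial3 L (t + 1) (yhat (t + 2)) (yhat (t + 2) - yhat (t + 1))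
        - partial3 L t (yhat (t + 1)) (yhat (t + 1) - yhat t)
      = partial2 L t (yhat (t + 1)) (yhat (t + 1) - yhat t) := by
  intro t ht
  rw [Finset.mem_Icc] at ht
  obtain ⟨ha, hb, δ, hδ, hmin⟩ := hext
  let e : ℤ → ℝ := fun k => if k = t + 1 then 1 else 0
  have he1 : ∀ k, e (k + 1) = if k = t then 1 else 0 := by
    intro k
    simp [e]
  have hea : e a = 0 := if_neg (by omega)
  have heb : e b = 0 := if_neg (by omega)
  have habs : ∀ k, |e k| ≤ 1 := by
    intro k
    by_cases h : k = t + 1 <;> simp [e, h]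
  let Y : ℝ → ℤ → ℝ := fun s k => yhat k + s * e k
  have hY0 : Y 0 = yhat := by
    funext k
    simp [Y]
  have hderiv : HasDerivAt (fun s => deltaFunctional a b L (Y s))
      (∑ k ∈ Finset.Icc a (b - 1),
        (partial2 L k (yhat (k + 1)) (yhat (k + 1) - yhat k) * e (k + 1)
          + partial3 L k (yhat (k + 1)) (yhat (k + 1) - yhat k) * (e (k + 1) - e k))) 0 := by
    unfold deltaFunctional
    apply HasDerivAt.fun_sum
    intro k _
    have h := hasDerivAt_along_line (L k) (hL k) (yhat (k + 1)) (yhat (k + 1) - yhat k)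
      (e (k + 1)) (e (k + 1) - e k)
    have hfun : (fun s => L k (Y s (k + 1)) (Y s (k + 1) - Y s k)) =
        fun s => L k (yhat (k + 1) + s * e (k + 1))
          (yhat (k + 1) - yhat k + s * (e (k + 1) - e k)) := by
      funext s
      simp only [Y]
      congr 1
      ring
    rw [hfun]
    exact h
  have hnear : ∀ᶠ s in nhds (0 : ℝ), ∀ k ∈ Finset.Icc a b, |Y s k - yhat k| < δ := by
    filter_upwards [Metric.ball_mem_nhds (0 : ℝ) hδ] with s hs k _
    rw [Metric.mem_ball, dist_zero_right, Real.norm_eq_abs] at hs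
    have : Y s k - yhat k = s * e k := by simp [Y]
    rw [this, abs_mul]
    nlinarith [habs k, abs_nonneg s, abs_nonneg (e k)]
  have hYa : ∀ s, Y s a = α := by
    intro s
    simp [Y, hea, ha]
  have hYb : ∀ s, Y s b = β := by
    intro s
    simp [Y, heb, hb]
  have hextr : IsLocalExtr (fun s => deltaFunctional a b L (Y s)) 0 := by
    rcases hmin with h | h
    · left
      filter_upwards [hnear] with s hs
      simpa only [hY0] using h (Y s) (hYa s) (hYb s) hs
    · right
      filter_upwards [hnear] with s hs
      simpa only [hY0] using h (Y s) (hYa s) (hYb s) hs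
  have hz := hextr.hasDerivAt_eq_zero hderiv
  have m1 : t ∈ Finset.Icc a (b - 1) := by
    rw [Finset.mem_Icc]
    omega
  have m2 : t + 1 ∈ Finset.Icc a (b - 1) := by
    rw [Finset.mem_Icc]
    omega
  simp only [he1, mul_sub, Finset.sum_add_distrib, Finset.sum_sub_distrib] at hz
  simp only [e, mul_ite, mul_one, mul_zero, Finset.sum_ite_eq', if_pos m1, if_pos m2] at hz
  rw [show t + 1 + 1 = t + 2 by ring] at hz
  linarith
end

section
/- Let a, b be integers with b ≥ a + 2, α, β ∈ ℝ, and let L : ℤ × ℝ × ℝ → ℝ be such that L(t,·,·) is continuously differentiable for each t. If ŷ : ℤ → ℝ is a local extremizer of J_∇(y) = Σ_{t=a+1}^{b} L(t, y(t−1), y(t) − y(t−1)) subject to y(a) = α, y(b) = β, then ŷ satisfies the nabla Euler-Lagrange difference equation: ∂₃L(t, ŷ(t−1), ŷ(t) − ŷ(t−1)) − ∂₃L(t−1, ŷ(t−2), ŷ(t−1) − ŷ(t−2)) = ∂₂L(t, ŷ(t−1), ŷ(t) − ŷ(t−1)) for all integers t with a + 2 ≤ t ≤ b. -/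
theorem hasDerivAt_line_aux (f : ℝ → ℝ → ℝ) (hf : ContDiff ℝ 1 (fun p : ℝ × ℝ => f p.1 p.2))
    (u v c d : ℝ) :
    HasDerivAt (fun e : ℝ => f (u + e * c) (v + e * d))
      (deriv (fun z => f z v) u * c + deriv (fun z => f u z) v * d) 0 := by
  have hd : HasFDerivAt (fun p : ℝ × ℝ => f p.1 p.2)
      (fderiv ℝ (fun p : ℝ × ℝ => f p.1 p.2) (u, v)) (u, v) :=
    ((hf.differentiable (by norm_num)) (u, v)).hasFDerivAt
  set D := fderiv ℝ (fun p : ℝ × ℝ => f p.1 p.2) (u, v)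
  have h1 : HasDerivAt (fun z => f z v) (D (1, 0)) u :=
    HasFDerivAt.comp_hasDerivAt (f := fun z : ℝ => (z, v)) u hd
      ((hasDerivAt_id u).prodMk (hasDerivAt_const u v))
  have h2 : HasDerivAt (fun z => f u z) (D (0, 1)) v :=
    HasFDerivAt.comp_hasDerivAt (f := fun z : ℝ => (u, z)) v hd
      ((hasDerivAt_const v u).prodMk (hasDerivAt_id v))
  have hu : HasDerivAt (fun e : ℝ => u + e * c) c 0 := by
    simpa using ((hasDerivAt_id (0 : ℝ)).mul_const c).const_add u
  have hv : HasDerivAt (fun e : ℝ => v + e * d) d 0 := by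
    simpa using ((hasDerivAt_id (0 : ℝ)).mul_const d).const_add v
  have h3 : HasDerivAt (fun e : ℝ => f (u + e * c) (v + e * d)) (D (c, d)) 0 :=
    HasFDerivAt.comp_hasDerivAt (l := fun p : ℝ × ℝ => f p.1 p.2)
      (f := fun e : ℝ => (u + e * c, v + e * d)) 0 (by simpa using hd) (hu.prodMk hv)
  rw [h1.deriv, h2.deriv]
  have e : D (c, d) = D (1, 0) * c + D (0, 1) * d := by
    have : ((c, d) : ℝ × ℝ) = c • ((1, 0) : ℝ × ℝ) + d • ((0, 1) : ℝ × ℝ) := by simp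
    rw [this, map_add, map_smul, map_smul, smul_eq_mul, smul_eq_mul]; ring
  rwa [e] at h3

/-- The nabla Euler-Lagrange difference equation on the time scale `T = ℤ`. -/
theorem eulerLagrange_nabla_differenceForm_int (a b : ℤ) (hab : a + 2 ≤ b) (α β : ℝ)
    (L : ℤ → ℝ → ℝ → ℝ)
    (hL : ∀ t : ℤ, ContDiff ℝ 1 (fun p : ℝ × ℝ => L t p.1 p.2))
    (yhat : ℤ → ℝ)
    (hext : IsLocalExtremizer a b α β (fun y => nablaFunctional a b L y) yhat) :
    ∀ t ∈ Finset.Icc (a + 2) b,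
      partial3 L t (yhat (t - 1)) (yhat t - yhat (t - 1))
        - partial3 L (t - 1) (yhat (t - 2)) (yhat (t - 1) - yhat (t - 2))
      = partial2 L t (yhat (t - 1)) (yhat t - yhat (t - 1)) := by
  intro t ht
  rw [Finset.mem_Icc] at ht
  obtain ⟨ha, hb, δ, hδ, hor⟩ := hext
  let h : ℤ → ℝ := fun r => if r = t - 1 then 1 else 0
  have hder : HasDerivAt (fun e : ℝ => nablaFunctional a b L (fun r => yhat r + e * h r))
      (∑ r ∈ Finset.Icc (a + 1) b,
        (partial2 L r (yhat (r - 1)) (yhat r - yhat (r - 1)) * h (r - 1)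
          + partial3 L r (yhat (r - 1)) (yhat r - yhat (r - 1)) * (h r - h (r - 1)))) 0 := by
    unfold nablaFunctional
    apply HasDerivAt.fun_sum
    intro r _
    have := hasDerivAt_line_aux (L r) (hL r) (yhat (r - 1)) (yhat r - yhat (r - 1))
      (h (r - 1)) (h r - h (r - 1))
    have e1 : ∀ e : ℝ, yhat r + e * h r - (yhat (r - 1) + e * h (r - 1))
        = yhat r - yhat (r - 1) + e * (h r - h (r - 1)) := fun e => by ring
    simp only [e1]
    exact this
  have hya : ∀ e : ℝ, yhat a + e * h a = α := by
    intro e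
    have : h a = 0 := if_neg (by omega)
    rw [this, ha]; ring
  have hyb : ∀ e : ℝ, yhat b + e * h b = β := by
    intro e
    have : h b = 0 := if_neg (by omega)
    rw [this, hb]; ring
  have hclose : ∀ e ∈ Metric.ball (0 : ℝ) δ, ∀ r ∈ Finset.Icc a b,
      |(yhat r + e * h r) - yhat r| < δ := by
    intro e he r _
    rw [Metric.mem_ball, Real.dist_eq, sub_zero] at he
    by_cases hr : r = t - 1
    · simpa [h, hr] using he
    · simpa [h, hr] using hδ
  have hnhds : Metric.ball (0 : ℝ) δ ∈ nhds (0 : ℝ) := Metric.ball_mem_nhds _ hδ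
  have hz : (fun r => yhat r + (0 : ℝ) * h r) = yhat := by funext r; ring
  have hlex : IsLocalExtr (fun e : ℝ => nablaFunctional a b L (fun r => yhat r + e * h r)) 0 := by
    rcases hor with hmin | hmax
    · left
      filter_upwards [hnhds] with e he
      simp only [hz]
      exact hmin _ (hya e) (hyb e) (hclose e he)
    · right
      filter_upwards [hnhds] with e he
      simp only [hz]
      exact hmax _ (hya e) (hyb e) (hclose e he)
  have h0 := hlex.hasDerivAt_eq_zero hder
  have hs : ∀ r : ℤ, h (r - 1) = if r = t then 1 else 0 := by
    intro r
    by_cases hr : r = t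
    · simp [h, hr]
    · simp [h, hr]
  have hm1 : t ∈ Finset.Icc (a + 1) b := Finset.mem_Icc.2 (by omega)
  have hm2 : t - 1 ∈ Finset.Icc (a + 1) b := Finset.mem_Icc.2 (by omega)
  simp only [hs, mul_sub, Finset.sum_add_distrib, Finset.sum_sub_distrib, h, mul_ite, mul_one,
    mul_zero, Finset.sum_ite_eq', if_pos hm1, if_pos hm2] at h0
  have e2 : t - 1 - 1 = t - 2 := by ring
  rw [e2] at h0
  linarith
end

section
/- Let a, b be integers with b ≥ a + 2, α, β ∈ ℝ, and let L_Δ, L_∇ : ℤ × ℝ × ℝ → ℝ be such that L_Δ(t,·,·) and L_∇(t,·,·) are continuously differentiable for each t. If ŷ : ℤ → ℝ is a local extremizer of J(y) = J_Δ(y)·J_∇(y) subject to y(a) = α, y(b) = β, then for every η : ℤ → ℝ with η(a) = η(b) = 0 one has: J_∇(ŷ)·Σ_{t=a}^{b−1} (∂₂L_Δ(t, ŷ(t+1), ŷ(t+1) − ŷ(t))·η(t+1) + ∂₃L_Δ(t, ŷ(t+1), ŷ(t+1) − ŷ(t))·(η(t+1) − η(t))) + J_Δ(ŷ)·Σ_{t=a+1}^{b}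 (∂₂L_∇(t, ŷ(t−1), ŷ(t) − ŷ(t−1))·η(t−1) + ∂₃L_∇(t, ŷ(t−1), ŷ(t) − ŷ(t−1))·(η(t) − η(t−1))) = 0. (This is the first-order necessary optimality condition from the proof of the paper's main theorem, on the time scale T = ℤ.) -/
/-- Chain rule for a Lagrangian along an affine variation. -/
theorem hasDerivAt_lagrangian_aux (L : ℤ → ℝ → ℝ → ℝ) (t : ℤ)
    (hL : ContDiff ℝ 1 (fun p : ℝ × ℝ => L t p.1 p.2)) (u v h k : ℝ) (f g : ℝ → ℝ)
    (hf : HasDerivAt f h 0) (hg : HasDerivAt g k 0) (hf0 : f 0 = u) (hg0 : g 0 = v) :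
    HasDerivAt (fun e : ℝ => L t (f e) (g e))
      (partial2 L t u v * h + partial3 L t u v * k) 0 := by
  subst hf0 hg0
  have hd : HasFDerivAt (fun p : ℝ × ℝ => L t p.1 p.2)
      (fderiv ℝ (fun p : ℝ × ℝ => L t p.1 p.2) (f 0, g 0)) (f 0, g 0) :=
    ((hL.differentiable (by norm_num)) _).hasFDerivAt
  set D := fderiv ℝ (fun p : ℝ × ℝ => L t p.1 p.2) (f 0, g 0) with hD
  have h2 : partial2 L t (f 0) (g 0) = D (1, 0) := by
    have hc : HasDerivAt (fun z : ℝ => (z, g 0)) ((1, 0) : ℝ × ℝ) (f 0) :=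
      (hasDerivAt_id (f 0)).prodMk (hasDerivAt_const (f 0) (g 0))
    have hk := HasFDerivAt.comp_hasDerivAt (f 0) hd hc
    exact hk.deriv
  have h3 : partial3 L t (f 0) (g 0) = D (0, 1) := by
    have hc : HasDerivAt (fun z : ℝ => (f 0, z)) ((0, 1) : ℝ × ℝ) (g 0) :=
      (hasDerivAt_const (g 0) (f 0)).prodMk (hasDerivAt_id (g 0))
    have hk := HasFDerivAt.comp_hasDerivAt (g 0) hd hc
    exact hk.deriv
  have h4 : D (h, k) = D (1, 0) * h + D (0, 1) * k := by
    have : ((h, k) : ℝ × ℝ) = h • ((1, 0) : ℝ × ℝ) + k • ((0, 1) : ℝ × ℝ) := by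
      simp
    rw [this, map_add, map_smul, map_smul, smul_eq_mul, smul_eq_mul]
    ring
  rw [h2, h3, ← h4]
  exact hd.comp_hasDerivAt 0 (hf.prodMk hg)

/-- The first-order necessary optimality condition (vanishing first variation)
for the delta-nabla product functional on the time scale `T = ℤ`. -/
theorem firstVariationVanishes_deltaNabla_int (a b : ℤ) (hab : a + 2 ≤ b) (α β : ℝ)
    (LD LN : ℤ → ℝ → ℝ → ℝ)
    (hLD : ∀ t : ℤ, ContDiff ℝ 1 (fun p : ℝ × ℝ => LD t p.1 p.2))
    (hLN : ∀ t : ℤ, ContDiff ℝ 1 (fun p : ℝ × ℝ => LN t p.1 p.2))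
    (yhat : ℤ → ℝ)
    (hext : IsLocalExtremizer a b α β
      (fun y => deltaFunctional a b LD y * nablaFunctional a b LN y) yhat) :
    ∀ η : ℤ → ℝ, η a = 0 → η b = 0 →
      nablaFunctional a b LN yhat *
        (∑ t ∈ Finset.Icc a (b - 1),
          (partial2 LD t (yhat (t + 1)) (yhat (t + 1) - yhat t) * η (t + 1)
            + partial3 LD t (yhat (t + 1)) (yhat (t + 1) - yhat t) * (η (t + 1) - η t))) +
      deltaFunctional a b LD yhat *
        (∑ t ∈ Finset.Icc (a + 1) b,
          (partial2 LN t (yhat (t - 1)) (yhat t - yhat (t - 1)) * η (t - 1)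
            + partial3 LN t (yhat (t - 1)) (yhat t - yhat (t - 1)) * (η t - η (t - 1)))) = 0 := by
  intro η ha hb
  obtain ⟨hya, hyb, δ, hδ, hor⟩ := hext
  have hlin : ∀ t : ℤ, HasDerivAt (fun e : ℝ => yhat t + e * η t) (η t) 0 := by
    intro t
    simpa using ((hasDerivAt_id (0 : ℝ)).mul_const (η t)).const_add (yhat t)
  have h1 : HasDerivAt (fun e : ℝ => deltaFunctional a b LD (fun t => yhat t + e * η t))
      (∑ t ∈ Finset.Icc a (b - 1),
          (partial2 LD t (yhat (t + 1)) (yhat (t + 1) - yhat t) * η (t + 1)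
            + partial3 LD t (yhat (t + 1)) (yhat (t + 1) - yhat t) * (η (t + 1) - η t))) 0 := by
    unfold deltaFunctional
    refine HasDerivAt.fun_sum fun t _ => ?_
    exact hasDerivAt_lagrangian_aux LD t (hLD t) _ _ _ _ _ _ (hlin (t + 1))
      ((hlin (t + 1)).sub (hlin t)) (by simp) (by simp)
  have h2 : HasDerivAt (fun e : ℝ => nablaFunctional a b LN (fun t => yhat t + e * η t))
      (∑ t ∈ Finset.Icc (a + 1) b,
          (partial2 LN t (yhat (t - 1)) (yhat t - yhat (t - 1)) * η (t - 1)
            + partial3 LN t (yhat (t - 1)) (yhat t - yhat (t - 1)) * (η t - η (t - 1)))) 0 := by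
    unfold nablaFunctional
    refine HasDerivAt.fun_sum fun t _ => ?_
    exact hasDerivAt_lagrangian_aux LN t (hLN t) _ _ _ _ _ _ (hlin (t - 1))
      ((hlin t).sub (hlin (t - 1))) (by simp) (by simp)
  have hprod := h1.fun_mul h2
  have hnear : ∀ᶠ e in nhds (0 : ℝ), ∀ t ∈ Finset.Icc a b,
      |(yhat t + e * η t) - yhat t| < δ := by
    rw [Filter.eventually_all_finset]
    intro t _
    have hc : Continuous fun e : ℝ => |(yhat t + e * η t) - yhat t| := by fun_prop
    exact hc.continuousAt.eventually_lt continuousAt_const (by simpa using hδ)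
  have hextr : IsLocalExtr (fun e : ℝ => deltaFunctional a b LD (fun t => yhat t + e * η t) *
      nablaFunctional a b LN (fun t => yhat t + e * η t)) 0 := by
    rcases hor with hmin | hmax
    · left
      filter_upwards [hnear] with e he
      simpa using hmin (fun t => yhat t + e * η t) (by simp [ha, hya]) (by simp [hb, hyb]) he
    · right
      filter_upwards [hnear] with e he
      simpa using hmax (fun t => yhat t + e * η t) (by simp [ha, hya]) (by simp [hb, hyb]) he
  have hz := hextr.hasDerivAt_eq_zero hprod
  simp only [zero_mul, add_zero] at hz
  linarith
end
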